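/- arXiv:0811.3055 — 2 statements merged into one kernel-verified Lean document; each statement's English description precedes it below -/
import Mathlib

section
/- Let k ≥ 2 be an integer and r > 0, 0 < ε < 1 constants. With high probability, HG(n, ⌈r n ln n⌉, k) contains a nonempty induced subhypergraph whose minimum vertex degree is at least (1 − ε) k r ln n (i.e., a ⌈(1−ε) k r ln n⌉-core exists). -/
/-- Sample space for the random `k`-uniform multihypergraph `HG(n,m,k)`: each of the `m`
hyperedges is a `k`-element subset of `[n]`, chosen independently and uniformly. -/
abbrev HGOmega (n m k : ℕ) := Fin m → {S : Finset (Fin n) // S.card = k}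

/-- The probability of an event under the uniform distribution on `HGOmega n m k`. -/
noncomputable def hgPr (n m k : ℕ) (E : HGOmega n m k → Prop) : ℝ :=
  haveI : DecidablePred E := Classical.decPred E
  ((Finset.univ.filter E).card : ℝ) / (Fintype.card (HGOmega n m k) : ℝ)

theorem Nat.choose_mul_pow_le_choose_mul_pow {a n : ℕ} (h : a ≤ n) (k : ℕ) :
    a.choose k * n ^ k ≤ n.choose k * a ^ k := by
  have desc : a.descFactorial k * n ^ k ≤ n.descFactorial k * a ^ k := by
    induction k with
    | zero => simp
    | succ k ih =>
      have hstep : (a - k) * n ≤ (n - k) * a := by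
        rw [Nat.sub_mul, Nat.sub_mul, mul_comm a n]
        exact Nat.sub_le_sub_left (Nat.mul_le_mul_left k h) _
      calc a.descFactorial (k + 1) * n ^ (k + 1)
          = ((a - k) * n) * (a.descFactorial k * n ^ k) := by
            rw [Nat.descFactorial_succ]; ring
        _ ≤ ((n - k) * a) * (n.descFactorial k * a ^ k) := Nat.mul_le_mul hstep ih
        _ = n.descFactorial (k + 1) * a ^ (k + 1) := by
            rw [Nat.descFactorial_succ]; ring
  rw [Nat.descFactorial_eq_factorial_mul_choose, Nat.descFactorial_eq_factorial_mul_choose,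
    mul_assoc, mul_assoc] at desc
  exact Nat.le_of_mul_le_mul_left desc k.factorial_pos

/-- If no nonempty induced subhypergraph has minimum degree at least `t`, then peeling off
low-degree vertices gives, for every `s ≤ n`, a set of `s` vertices meeting at most `s * t` edges. -/
theorem exists_card_eq_touching_le {n m : ℕ} (e : Fin m → Finset (Fin n)) (t : ℝ)
    (h : ¬ ∃ V' : Finset (Fin n), V'.Nonempty ∧ ∀ v ∈ V',
      ((Finset.univ.filter (fun j => v ∈ e j ∧ e j ⊆ V')).card : ℝ) ≥ t)
    (s : ℕ) (hs : s ≤ n) :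
    ∃ S : Finset (Fin n), S.card = s ∧
      ((Finset.univ.filter (fun j => ¬ e j ⊆ Sᶜ)).card : ℝ) ≤ s * t := by
  induction s with
  | zero => exact ⟨∅, by simp⟩
  | succ s ih =>
    obtain ⟨S, hcard, hS⟩ := ih (by omega)
    push Not at h
    have hne : Sᶜ.Nonempty := by
      rw [← Finset.card_pos, Finset.card_compl, Fintype.card_fin]
      omega
    obtain ⟨v, hv, hdeg⟩ := h Sᶜ hne
    have hvS : v ∉ S := by simpa using hv
    refine ⟨insert v S, by rw [Finset.card_insert_of_notMem hvS, hcard], ?_⟩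
    have hsub : Finset.univ.filter (fun j => ¬ e j ⊆ (insert v S)ᶜ) ⊆
        Finset.univ.filter (fun j => ¬ e j ⊆ Sᶜ) ∪
          Finset.univ.filter (fun j => v ∈ e j ∧ e j ⊆ Sᶜ) := by
      intro j hj
      simp only [Finset.mem_filter, Finset.mem_univ, true_and, Finset.mem_union] at hj ⊢
      by_cases hjS : e j ⊆ Sᶜ
      · refine Or.inr ⟨?_, hjS⟩
        by_contra hvj
        refine hj fun x hx => ?_
        have hxS := hjS hx
        simp only [Finset.mem_compl, Finset.mem_insert, not_or] at hxS ⊢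
        exact ⟨fun hxv => hvj (hxv ▸ hx), hxS⟩
      · exact Or.inl hjS
    have hle : ((Finset.univ.filter (fun j => ¬ e j ⊆ (insert v S)ᶜ)).card : ℝ) ≤
        (Finset.univ.filter (fun j => ¬ e j ⊆ Sᶜ)).card +
          (Finset.univ.filter (fun j => v ∈ e j ∧ e j ⊆ Sᶜ)).card := by
      exact_mod_cast (Finset.card_le_card hsub).trans (Finset.card_union_le _ _)
    push_cast
    linarith

/-- Chernoff's bound for the lower tail of the number of trials landing in `{x | P x}`, among `m`
independent uniform trials in `α`. -/
theorem card_filter_count_le_le_exp {α : Type*} [Fintype α] (P : α → Prop)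
    [DecidablePred P] (m : ℕ) (p c a : ℝ) (hc : 0 ≤ c)
    (hp : p * Fintype.card α ≤ (Finset.univ.filter P).card) :
    ((Finset.univ.filter (fun ω : Fin m → α =>
      ((Finset.univ.filter (fun j => P (ω j))).card : ℝ) ≤ a)).card : ℝ) ≤
      Real.exp (c * a - m * (p * (1 - Real.exp (-c)))) * (Fintype.card α : ℝ) ^ m := by
  have hsum : ∑ x : α, (if P x then Real.exp (-c) else 1) ≤
      Fintype.card α * Real.exp (-(p * (1 - Real.exp (-c)))) := by
    have hexp : Real.exp (-c) ≤ 1 := by simpa using hc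
    have heq : ∑ x : α, (if P x then Real.exp (-c) else 1) =
        Fintype.card α - (Finset.univ.filter P).card * (1 - Real.exp (-c)) := by
      have hx : ∀ x : α, (if P x then Real.exp (-c) else 1) =
          1 - (if P x then 1 else 0) * (1 - Real.exp (-c)) := by
        intro x; split_ifs <;> ring
      simp_rw [hx]
      rw [Finset.sum_sub_distrib, ← Finset.sum_mul]
      simp
    rw [heq]
    have h1 := mul_le_mul_of_nonneg_right hp (sub_nonneg.2 hexp)
    have h2 := mul_le_mul_of_nonneg_left (Real.add_one_le_exp (-(p * (1 - Real.exp (-c)))))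
      (Nat.cast_nonneg (α := ℝ) (Fintype.card α))
    linarith
  have hnonneg : ∀ x : α, 0 ≤ (if P x then Real.exp (-c) else 1) := by
    intro x; split_ifs <;> positivity
  have hprod : ∀ ω : Fin m → α, ∏ j, (if P (ω j) then Real.exp (-c) else 1) =
      Real.exp (-c * (Finset.univ.filter (fun j => P (ω j))).card) := by
    intro ω
    rw [Finset.prod_ite, Finset.prod_const, Finset.prod_const_one, mul_one, ← Real.exp_nat_mul,
      mul_comm]
  calc ((Finset.univ.filter (fun ω : Fin m → α =>
      ((Finset.univ.filter (fun j => P (ω j))).card : ℝ) ≤ a)).card : ℝ)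
      = ∑ ω ∈ Finset.univ.filter (fun ω : Fin m → α =>
          ((Finset.univ.filter (fun j => P (ω j))).card : ℝ) ≤ a), (1 : ℝ) := by simp
    _ ≤ ∑ ω ∈ Finset.univ.filter (fun ω : Fin m → α =>
          ((Finset.univ.filter (fun j => P (ω j))).card : ℝ) ≤ a),
          Real.exp (c * a) * ∏ j, (if P (ω j) then Real.exp (-c) else 1) := by
        refine Finset.sum_le_sum fun ω hω => ?_
        rw [hprod, ← Real.exp_add, Real.one_le_exp_iff]
        have := mul_le_mul_of_nonneg_left (Finset.mem_filter.1 hω).2 hc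
        linarith
    _ ≤ ∑ ω : Fin m → α, Real.exp (c * a) * ∏ j, (if P (ω j) then Real.exp (-c) else 1) := by
        refine Finset.sum_le_sum_of_subset_of_nonneg (Finset.filter_subset _ _) fun ω _ _ => ?_
        exact mul_nonneg (Real.exp_pos _).le (Finset.prod_nonneg fun j _ => hnonneg _)
    _ = Real.exp (c * a) * (∑ x : α, (if P x then Real.exp (-c) else 1)) ^ m := by
        rw [← Finset.mul_sum, Fintype.sum_pow]
    _ ≤ Real.exp (c * a) * (Fintype.card α * Real.exp (-(p * (1 - Real.exp (-c))))) ^ m := by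
        gcongr
    _ = Real.exp (c * a - m * (p * (1 - Real.exp (-c)))) * (Fintype.card α : ℝ) ^ m := by
        rw [mul_pow, ← Real.exp_nat_mul, sub_eq_add_neg (c * a), Real.exp_add, mul_neg]
        ring

theorem card_subtype_subset_eq_choose {n : ℕ} (k : ℕ) (T : Finset (Fin n)) :
    (Finset.univ.filter (fun e : {S : Finset (Fin n) // S.card = k} => e.1 ⊆ T)).card =
      T.card.choose k := by
  rw [← Finset.card_powersetCard]
  refine Finset.card_bij (fun e _ => e.1) ?_ ?_ ?_
  · intro e he
    exact Finset.mem_powersetCard.2 ⟨(Finset.mem_filter.1 he).2, e.2⟩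
  · intro e _ f _ hef
    exact Subtype.ext hef
  · intro S hS
    obtain ⟨hST, hSk⟩ := Finset.mem_powersetCard.1 hS
    exact ⟨⟨S, hSk⟩, by simpa using hST, rfl⟩

/-- A set `S` of vertices with `y = k * |S| / n ≤ 1` meets at least a `y * (1 - y)` fraction of
all `k`-subsets. -/
theorem le_card_touching {n k : ℕ} (hn : 0 < n) (S : Finset (Fin n)) (y : ℝ)
    (hy : (k : ℝ) * S.card = y * n) (hy1 : y ≤ 1) :
    y * (1 - y) * Fintype.card {S : Finset (Fin n) // S.card = k} ≤
      (Finset.univ.filter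
        (fun e : {S : Finset (Fin n) // S.card = k} => ¬ e.1 ⊆ Sᶜ)).card := by
  have hn' : (0 : ℝ) < n := by exact_mod_cast hn
  have hy0 : 0 ≤ y := by
    have : 0 ≤ y * n := hy ▸ by positivity
    exact nonneg_of_mul_nonneg_left this hn'
  have hSn : S.card ≤ n := by simpa using S.card_le_univ
  have htot : Fintype.card {S : Finset (Fin n) // S.card = k} = n.choose k := by
    rw [Fintype.card_finset_len, Fintype.card_fin]
  have hsplit := Finset.card_filter_add_card_filter_not
    (s := (Finset.univ : Finset {S : Finset (Fin n) // S.card = k})) (fun e => e.1 ⊆ Sᶜ)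
  rw [card_subtype_subset_eq_choose, Finset.card_univ, htot, Finset.card_compl,
    Fintype.card_fin] at hsplit
  rw [htot]
  have hsplit' : ((n - S.card).choose k : ℝ) + (Finset.univ.filter
      (fun e : {S : Finset (Fin n) // S.card = k} => ¬ e.1 ⊆ Sᶜ)).card = n.choose k := by
    exact_mod_cast hsplit
  have hchoose : ((n - S.card).choose k : ℝ) * (n : ℝ) ^ k ≤
      n.choose k * ((n : ℝ) - S.card) ^ k := by
    rw [← Nat.cast_sub hSn]
    exact_mod_cast Nat.choose_mul_pow_le_choose_mul_pow (Nat.sub_le n S.card) k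
  have hpow : ((n : ℝ) - S.card) ^ k ≤ (1 - y * (1 - y)) * (n : ℝ) ^ k := by
    have h1 : (n : ℝ) - S.card = (1 - S.card / n) * n := by field_simp
    have h0 : 0 ≤ 1 - (S.card : ℝ) / n := by
      rw [sub_nonneg, div_le_one hn']
      exact_mod_cast hSn
    rw [h1, mul_pow]
    gcongr
    calc (1 - (S.card : ℝ) / n) ^ k ≤ Real.exp (-(S.card / n)) ^ k := by
          gcongr
          linarith [Real.add_one_le_exp (-((S.card : ℝ) / n))]
      _ = Real.exp (-y) := by
          rw [← Real.exp_nat_mul]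
          congr 1
          field_simp
          linarith
      _ ≤ 1 - y * (1 - y) := by
          have := (abs_le.1 (Real.abs_exp_sub_one_sub_id_le (x := -y)
            (by rw [abs_neg, abs_of_nonneg hy0]; exact hy1))).2
          nlinarith
  have hfin : ((n - S.card).choose k : ℝ) ≤ n.choose k * (1 - y * (1 - y)) := by
    have hnk : (0 : ℝ) < (n : ℝ) ^ k := by positivity
    refine le_of_mul_le_mul_right ?_ hnk
    calc _ ≤ _ := hchoose
      _ ≤ n.choose k * ((1 - y * (1 - y)) * (n : ℝ) ^ k) := by gcongr
      _ = _ := by ring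
  linarith

theorem hgPr_le_one (n m k : ℕ) (E : HGOmega n m k → Prop) : hgPr n m k E ≤ 1 := by
  classical
  unfold hgPr
  refine div_le_one_of_le₀ ?_ (Nat.cast_nonneg _)
  exact_mod_cast Finset.card_le_univ _

theorem one_sub_le_hgPr {n m k : ℕ} (E : HGOmega n m k → Prop) [DecidablePred E] (b : ℝ)
    (hN : 0 < Fintype.card (HGOmega n m k))
    (hb : ((Finset.univ.filter (fun ω => ¬ E ω)).card : ℝ) ≤
      b * Fintype.card (HGOmega n m k)) :
    1 - b ≤ hgPr n m k E := by
  unfold hgPr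
  have hN' : (0 : ℝ) < Fintype.card (HGOmega n m k) := by exact_mod_cast hN
  rw [le_div_iff₀ hN']
  have hsplit := Finset.card_filter_add_card_filter_not
    (s := (Finset.univ : Finset (HGOmega n m k))) E
  rw [Finset.card_univ] at hsplit
  have hsplit' : ((Finset.univ.filter E).card : ℝ) +
      (Finset.univ.filter (fun ω => ¬ E ω)).card = Fintype.card (HGOmega n m k) := by
    exact_mod_cast hsplit
  have : ((@Finset.filter _ E (Classical.decPred E) Finset.univ).card : ℝ) =
      (Finset.univ.filter E).card := by congr!
  rw [this]
  linarith

/-- Union bound over all `s`-sets that could be the first `s` vertices peeled off. -/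
theorem one_sub_le_hgPr_core {n m k s : ℕ} (hkn : k ≤ n) (hn : 0 < n) (hs : s ≤ n) (t y c : ℝ)
    (hy : (k : ℝ) * s = y * n) (hy1 : y ≤ 1) (hc : 0 ≤ c) :
    1 - 2 ^ n * Real.exp (c * (s * t) - m * (y * (1 - y) * (1 - Real.exp (-c)))) ≤
      hgPr n m k (fun ω => ∃ V' : Finset (Fin n), V'.Nonempty ∧ ∀ v ∈ V',
        ((Finset.univ.filter (fun j => v ∈ (ω j).1 ∧ (ω j).1 ⊆ V')).card : ℝ) ≥ t) := by
  classical
  have hcard : 0 < Fintype.card {S : Finset (Fin n) // S.card = k} := by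
    rw [Fintype.card_finset_len, Fintype.card_fin]
    exact Nat.choose_pos hkn
  have hω : Fintype.card (HGOmega n m k) =
      Fintype.card {S : Finset (Fin n) // S.card = k} ^ m := by
    rw [Fintype.card_fun, Fintype.card_fin]
  refine one_sub_le_hgPr _ _ (by rw [hω]; exact pow_pos hcard m) ?_
  set B : ℝ := Real.exp (c * (s * t) - m * (y * (1 - y) * (1 - Real.exp (-c)))) *
    (Fintype.card {S : Finset (Fin n) // S.card = k} : ℝ) ^ m with hB
  let bad (S : Finset (Fin n)) : Finset (HGOmega n m k) := Finset.univ.filter fun ω =>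
    ((Finset.univ.filter (fun j => ¬ (ω j).1 ⊆ Sᶜ)).card : ℝ) ≤ s * t
  calc _ ≤ (((Finset.univ.filter (fun S : Finset (Fin n) => S.card = s)).biUnion bad).card : ℝ) := by
        refine Nat.cast_le.2 (Finset.card_le_card fun ω hω => ?_)
        obtain ⟨S, hS, hle⟩ := exists_card_eq_touching_le (fun j => (ω j).1) t
          (Finset.mem_filter.1 hω).2 s hs
        exact Finset.mem_biUnion.2 ⟨S, by simpa using hS, by simpa [bad] using hle⟩
    _ ≤ ∑ S ∈ Finset.univ.filter (fun S : Finset (Fin n) => S.card = s), ((bad S).card : ℝ) := by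
        exact_mod_cast Finset.card_biUnion_le
    _ ≤ ∑ S ∈ Finset.univ.filter (fun S : Finset (Fin n) => S.card = s), B := by
        refine Finset.sum_le_sum fun S hS => ?_
        have hS' : S.card = s := (Finset.mem_filter.1 hS).2
        have htail := card_filter_count_le_le_exp
          (fun e : {S : Finset (Fin n) // S.card = k} => ¬ e.1 ⊆ Sᶜ) m _ c (s * t) hc
          (le_card_touching hn S y (by rw [hS', hy]) hy1)
        convert htail
    _ ≤ 2 ^ n * B := by
        rw [Finset.sum_const, nsmul_eq_mul]
        gcongr
        have hle := Finset.card_le_univ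
          (Finset.univ.filter (fun S : Finset (Fin n) => S.card = s))
        rw [Fintype.card_finset, Fintype.card_fin] at hle
        exact_mod_cast hle
    _ = _ := by
        rw [hB, hω, Nat.cast_pow]
        ring

theorem chernoff_exponent_le {k s n m : ℕ} {r ε y L : ℝ} (hn : 0 < n) (hr : 0 < r) (hε0 : 0 < ε)
    (hε1 : ε < 1) (hL : 0 ≤ L) (hy : (k : ℝ) * s = y * n) (hy4 : y ≤ ε / 4)
    (hm : r * n * L ≤ m) :
    ε / 4 * (s * ((1 - ε) * k * r * L)) - m * (y * (1 - y) * (1 - Real.exp (-(ε / 4)))) ≤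
      -(ε ^ 2 / 8 * r * L * (y * n)) := by
  have hn' : (0 : ℝ) < n := by exact_mod_cast hn
  have hy0 : 0 ≤ y := by
    have : 0 ≤ y * n := hy ▸ by positivity
    exact nonneg_of_mul_nonneg_left this hn'
  have hexp : ε / 4 * (1 - ε / 4) ≤ 1 - Real.exp (-(ε / 4)) := by
    have := (abs_le.1 (Real.abs_exp_sub_one_sub_id_le (x := -(ε / 4))
      (by rw [abs_neg, abs_of_nonneg (by positivity)]; linarith))).2
    nlinarith
  have h1 : (0 : ℝ) ≤ 1 - ε / 4 := by linarith
  have hy1 : (0 : ℝ) ≤ 1 - y := by linarith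
  have hlow : r * n * L * (y * (1 - ε / 4) * (ε / 4 * (1 - ε / 4))) ≤
      m * (y * (1 - y) * (1 - Real.exp (-(ε / 4)))) := by
    gcongr
  have hs : (s : ℝ) * ((1 - ε) * k * r * L) = (1 - ε) * r * L * (y * n) := by
    rw [← hy]; ring
  rw [hs]
  have hA : 0 ≤ r * L * (y * n) * ε ^ 3 := by positivity
  nlinarith

/-- For `k ≥ 2`, `r > 0` and `0 < ε < 1`, with high probability `HG(n, ⌈r n ln n⌉, k)`
contains a nonempty induced subhypergraph (a nonempty vertex subset `V'` together with all
hyperedges contained in `V'`) whose minimum vertex degree is at least `(1 - ε) k r ln n`,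
i.e. a `⌈(1-ε) k r ln n⌉`-core exists. -/
theorem hg_core_exists (k : ℕ) (hk : 2 ≤ k) (r ε : ℝ) (hr : 0 < r) (hε0 : 0 < ε)
    (hε1 : ε < 1) :
    Filter.Tendsto
      (fun n : ℕ => hgPr n ⌈r * n * Real.log n⌉₊ k
        (fun ω => ∃ V' : Finset (Fin n), V'.Nonempty ∧ ∀ v ∈ V',
          ((Finset.univ.filter (fun j => v ∈ (ω j).1 ∧ (ω j).1 ⊆ V')).card : ℝ) ≥
            (1 - ε) * k * r * Real.log n))
      Filter.atTop (nhds 1) := by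
  have hk0 : (0 : ℝ) < k := by positivity
  have hexp : Filter.Tendsto (fun n : ℕ => 1 - Real.exp (-(n : ℝ))) Filter.atTop (nhds 1) := by
    simpa using (Real.tendsto_exp_neg_atTop_nhds_zero.comp
      tendsto_natCast_atTop_atTop).const_sub (1 : ℝ)
  refine tendsto_of_tendsto_of_tendsto_of_le_of_le' hexp tendsto_const_nhds ?_
    (Filter.Eventually.of_forall fun n => hgPr_le_one _ _ _ _)
  have hlog : Filter.Tendsto (fun n : ℕ => Real.log n) Filter.atTop Filter.atTop :=
    Real.tendsto_log_atTop.comp tendsto_natCast_atTop_atTop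
  filter_upwards [Filter.eventually_ge_atTop k,
    tendsto_natCast_atTop_atTop.eventually_ge_atTop (8 * k / ε),
    hlog.eventually_ge_atTop (2 / (ε ^ 2 / 8 * r * (ε / 8)))] with n hkn hnlarge hloglarge
  have hn : 0 < n := by omega
  have hn' : (0 : ℝ) < n := by exact_mod_cast hn
  set L := Real.log n with hLdef
  have hL : 0 ≤ L := le_trans (by positivity) hloglarge
  set s := ⌊ε * n / (4 * k)⌋₊ with hsdef
  have hs_le : (s : ℝ) ≤ ε * n / (4 * k) := Nat.floor_le (by positivity)
  have hs_lt : ε * n / (4 * k) < s + 1 := Nat.lt_floor_add_one _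
  rw [le_div_iff₀ (by positivity)] at hs_le
  rw [div_lt_iff₀ (by positivity)] at hs_lt
  rw [div_le_iff₀ hε0] at hnlarge
  have hy : (k : ℝ) * s = k * s / n * n := by field_simp
  have hy4 : (k : ℝ) * s / n ≤ ε / 4 := by
    rw [div_le_iff₀ hn']; linarith
  have hsn : s ≤ n := by
    have hk1 : (1 : ℝ) ≤ k := by exact_mod_cast (by omega : 1 ≤ k)
    have : (s : ℝ) ≤ n := by nlinarith [Nat.cast_nonneg (α := ℝ) s]
    exact_mod_cast this
  refine le_trans ?_ (one_sub_le_hgPr_core hkn hn hsn _ _ (ε / 4) hy (by linarith) (by positivity))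
  have hchern := chernoff_exponent_le hn hr hε0 hε1 hL hy hy4 (Nat.le_ceil (r * n * L))
  have hsize : ε / 8 * n ≤ k * s / n * n := by rw [← hy]; linarith
  rw [div_le_iff₀ (by positivity)] at hloglarge
  have hneg : 2 * (n : ℝ) ≤ ε ^ 2 / 8 * r * L * (k * s / n * n) :=
    calc 2 * (n : ℝ) ≤ L * (ε ^ 2 / 8 * r * (ε / 8)) * n := by gcongr
      _ = ε ^ 2 / 8 * r * L * (ε / 8 * n) := by ring
      _ ≤ _ := by gcongr
  have htwo : (2 : ℝ) ^ n ≤ Real.exp n := by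
    rw [← mul_one (n : ℝ), Real.exp_nat_mul]
    gcongr
    linarith [Real.add_one_le_exp (1 : ℝ)]
  have hsmall : (2 : ℝ) ^ n * Real.exp (ε / 4 * (s * ((1 - ε) * k * r * L)) -
      ⌈r * n * L⌉₊ * (k * s / n * (1 - k * s / n) * (1 - Real.exp (-(ε / 4))))) ≤
      Real.exp (-(n : ℝ)) := by
    calc _ ≤ Real.exp n * Real.exp (-(2 * n)) := by
          gcongr
          linarith
      _ = Real.exp (-(n : ℝ)) := by
          rw [← Real.exp_add]; congr 1; ring
  linarith
end

section
/- Let α > 0, p ∈ (0,1), integer k ≥ 2 be constants and let r_bf = −α/(k ln(1−p)). If r < r_bf, then the probability that a random instance of Model RD is backtrack-free tends to 1 as n → ∞. -/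
/-- Sample space for a random instance of Model RD with `n` variables, domain `Fin d`,
`m` constraints, each constraint scope a `k`-element set of variables: the first component
gives the scopes, the second gives, for each constraint, a boolean flag for every partial
assignment (the flags indexed by partial assignments supported exactly on the scope
determine which scope-assignments are compatible). -/
abbrev RDOmega (n d m k : ℕ) :=
  (Fin m → {S : Finset (Fin n) // S.card = k}) × (Fin m → (Fin n → Option (Fin d)) → Bool)

/-- The probability weight of an outcome: scopes are uniform among `k`-element subsets,
and each flag is `true` independently with probability `1 - p`. -/
noncomputable def rdWeight (p : ℝ) {n d m k : ℕ} (ω : RDOmega n d m k) : ℝ :=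
  ((Fintype.card {S : Finset (Fin n) // S.card = k} : ℝ))⁻¹ ^ m *
    ∏ i : Fin m, ∏ g : Fin n → Option (Fin d), (if ω.2 i g then 1 - p else p)

/-- The probability of an event for Model RD. -/
noncomputable def rdPr (p : ℝ) (n d m k : ℕ) (E : RDOmega n d m k → Prop) : ℝ :=
  haveI : DecidablePred E := Classical.decPred E
  ∑ ω ∈ Finset.univ.filter E, rdWeight p ω

/-- The (total) assignment `c` is compatible with constraint `i`: the flag of the
restriction of `c` to the scope of `i` is `true`. Since only the restriction of `c` to
the scope is consulted, this expresses compatibility of any partial assignment defined on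
a superset of the scope. -/
def rdCompat {n d m k : ℕ} (ω : RDOmega n d m k) (i : Fin m) (c : Fin n → Fin d) : Prop :=
  ω.2 i (fun v => if v ∈ (ω.1 i).1 then some (c v) else none) = true

/-- The random instance `ω` of Model RD is backtrack-free: there is an ordering
`π 0 < π 1 < ...` of the variables such that every partial assignment on an initial
segment compatible with all constraints whose scope lies in that segment extends to the
next variable compatibly with all constraints whose scope lies in the extended segment. -/
def rdBacktrackFree {n d m k : ℕ} (ω : RDOmega n d m k) : Prop :=
  ∃ π : Equiv.Perm (Fin n), ∀ i : Fin n, ∀ c : Fin n → Fin d,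
    (∀ j, (ω.1 j).1 ⊆ (Finset.Iio i).image π → rdCompat ω j c) →
    ∃ v : Fin d, ∀ j, (ω.1 j).1 ⊆ (Finset.Iic i).image π →
      rdCompat ω j (Function.update c (π i) v)

open Finset

/-- The weight of a family of independent flags, each `true` with probability `1 - p`. -/
noncomputable def flagWeight {X : Type*} [Fintype X] (p : ℝ) (F : X → Bool) : ℝ :=
  ∏ x, if F x then 1 - p else p

lemma flagWeight_nonneg {X : Type*} [Fintype X] {p : ℝ} (hp0 : 0 ≤ p) (hp1 : p ≤ 1)
    (F : X → Bool) : 0 ≤ flagWeight p F :=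
  prod_nonneg fun x _ => by split_ifs <;> linarith

lemma sum_flagWeight_mul_prod {X : Type*} [Fintype X] [DecidableEq X] (p : ℝ) (Y : Finset X) :
    ∑ F : X → Bool, flagWeight p F * ∏ x ∈ Y, (if F x then (1 : ℝ) else 0) = (1 - p) ^ #Y := by
  have h : ∀ F : X → Bool, flagWeight p F * ∏ x ∈ Y, (if F x then (1 : ℝ) else 0) =
      ∏ x, (if F x then 1 - p else p) * (if x ∈ Y then (if F x then (1 : ℝ) else 0) else 1) := by
    intro F
    rw [prod_mul_distrib, prod_ite_mem, univ_inter, flagWeight]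
  simp_rw [h]
  rw [← Fintype.prod_sum
    (fun x (b : Bool) => (if b then 1 - p else p) *
      (if x ∈ Y then (if b then (1 : ℝ) else 0) else 1))]
  have h2 : ∀ x : X, ∑ b : Bool, (if b then 1 - p else p) *
      (if x ∈ Y then (if b then (1 : ℝ) else 0) else 1) = if x ∈ Y then 1 - p else 1 := by
    intro x
    by_cases hx : x ∈ Y <;> simp [hx]
  simp_rw [h2]
  rw [prod_ite_mem, univ_inter, prod_const]

lemma sum_flagWeight {X : Type*} [Fintype X] [DecidableEq X] (p : ℝ) :
    ∑ F : X → Bool, flagWeight p F = 1 := by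
  simpa using sum_flagWeight_mul_prod p (∅ : Finset X)

/-- Disjoint blocks of independent flags fail to be all `true` independently of each other. -/
lemma sum_flagWeight_mul_prod_one_sub {X V : Type*} [Fintype X] [DecidableEq X] [DecidableEq V]
    (p : ℝ) (s : Finset V) (A : V → Finset X) (hA : (s : Set V).PairwiseDisjoint A) :
    ∑ F : X → Bool, flagWeight p F *
      ∏ v ∈ s, (1 - ∏ x ∈ A v, (if F x then (1 : ℝ) else 0)) =
      ∏ v ∈ s, (1 - (1 - p) ^ #(A v)) := by
  simp_rw [prod_sub, mul_sum]
  rw [sum_comm]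
  refine sum_congr rfl fun t ht => ?_
  have hd : (t : Set V).PairwiseDisjoint A := hA.subset (by simpa using ht)
  calc _ = (-1) ^ #t * ∑ F : X → Bool, flagWeight p F *
            ∏ x ∈ t.biUnion A, (if F x then (1 : ℝ) else 0) := by
        rw [mul_sum]
        refine sum_congr rfl fun F _ => ?_
        rw [prod_biUnion hd]
        simp
        ring
    _ = _ := by
        rw [sum_flagWeight_mul_prod, card_biUnion hd, prod_pow_eq_pow_sum]
        simp

/-- The probability that each of finitely many disjoint blocks of independent flags contains
a `false` flag. -/
lemma sum_flagWeight_forall_exists_false {X V : Type*} [Fintype X] [DecidableEq X]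
    [Fintype V] [DecidableEq V] (p : ℝ) (A : V → Finset X)
    (hA : Pairwise fun v w => Disjoint (A v) (A w)) [DecidablePred fun F : X → Bool =>
      ∀ v, ∃ x ∈ A v, F x = false] :
    ∑ F : X → Bool with (∀ v, ∃ x ∈ A v, F x = false), flagWeight p F =
      ∏ v, (1 - (1 - p) ^ #(A v)) := by
  rw [← sum_flagWeight_mul_prod_one_sub p univ A (fun v _ w _ h => hA h), sum_filter]
  refine sum_congr rfl fun F _ => ?_
  split_ifs with h
  · rw [prod_eq_one, mul_one]
    intro v _
    obtain ⟨x, hx, hF⟩ := h v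
    rw [prod_eq_zero hx (by simp [hF]), sub_zero]
  · push Not at h
    obtain ⟨v, hv⟩ := h
    rw [prod_eq_zero (mem_univ v), mul_zero]
    rw [prod_eq_one, sub_self]
    intro x hx
    have := hv x hx
    simp at this
    simp [this]

/-- Markov's inequality for `exp (θ * #{j | f j ∈ Q})` with `f` a uniformly random map. -/
lemma card_filter_le_exp {T : Type*} [Fintype T] [DecidableEq T] (m : ℕ) (Q : Finset T)
    (t θ : ℝ) (hθ : 0 ≤ θ) :
    (#{f : Fin m → T | t ≤ #{j | f j ∈ Q}} : ℝ) ≤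
      Real.exp (-(θ * t)) * (Fintype.card T + (Real.exp θ - 1) * #Q) ^ m := by
  have h1 : ∀ f : Fin m → T, (∏ j, if f j ∈ Q then Real.exp θ else 1) =
      Real.exp (θ * #{j | f j ∈ Q}) := by
    intro f
    rw [prod_ite, prod_const, prod_const_one, mul_one, ← Real.exp_nat_mul, mul_comm]
  have h2 : (∑ a : T, if a ∈ Q then Real.exp θ else 1) =
      Fintype.card T + (Real.exp θ - 1) * #Q := by
    have : ∀ a : T, (if a ∈ Q then Real.exp θ else 1) =
        1 + if a ∈ Q then Real.exp θ - 1 else 0 := by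
      intro a; split_ifs <;> ring
    simp_rw [this, sum_add_distrib, sum_ite_mem]
    simp
    ring
  rw [← h2, Fintype.sum_pow, mul_sum, card_eq_sum_ones, Nat.cast_sum, sum_filter]
  refine sum_le_sum fun f _ => ?_
  rw [h1, ← Real.exp_add]
  split_ifs with h
  · rw [Nat.cast_one]
    apply Real.one_le_exp
    nlinarith
  · positivity

lemma descFactorial_mul_sq_le {s n : ℕ} (hs : s ≤ n) {k : ℕ} (hk : 2 ≤ k) :
    s.descFactorial k * n ^ 2 ≤ n.descFactorial k * s ^ 2 := by
  induction k, hk using Nat.le_induction with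
  | base =>
    simp only [Nat.descFactorial_succ, Nat.descFactorial_zero, Nat.sub_zero, mul_one]
    have : (s - 1) * n ≤ (n - 1) * s := by
      rw [Nat.sub_mul, Nat.sub_mul, mul_comm n s]; omega
    nlinarith [Nat.mul_le_mul_right (s * n) this]
  | succ k hk ih =>
    rw [Nat.descFactorial_succ, Nat.descFactorial_succ, mul_assoc, mul_assoc]
    exact Nat.mul_le_mul (by omega) ih

lemma choose_mul_sq_le {s n : ℕ} (hs : s ≤ n) {k : ℕ} (hk : 2 ≤ k) :
    s.choose k * n ^ 2 ≤ n.choose k * s ^ 2 := by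
  have h := descFactorial_mul_sq_le hs hk
  rw [Nat.descFactorial_eq_factorial_mul_choose, Nat.descFactorial_eq_factorial_mul_choose,
    mul_assoc, mul_assoc] at h
  exact Nat.le_of_mul_le_mul_left h k.factorial_pos

lemma card_subtype_subset {n k : ℕ} (S : Finset (Fin n)) :
    #{T : {T : Finset (Fin n) // #T = k} | T.1 ⊆ S} = (#S).choose k := by
  rw [← card_powersetCard, ← card_map (Function.Embedding.subtype _)]
  congr 1
  ext T
  simp [mem_powersetCard, and_comm]

/-- Chernoff bound for the number of random `k`-element scopes contained in a fixed set `S`. -/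
lemma card_dense_le_exp {n k m : ℕ} (hk : 2 ≤ k) (hkn : k ≤ n) (S : Finset (Fin n))
    (t θ : ℝ) (hθ : 0 ≤ θ) :
    (#{f : Fin m → {T : Finset (Fin n) // #T = k} | t ≤ #{j | (f j).1 ⊆ S}} : ℝ) ≤
      (Fintype.card {T : Finset (Fin n) // #T = k} : ℝ) ^ m *
      Real.exp (m * ((#S / n : ℝ) ^ 2 * (Real.exp θ - 1)) - θ * t) := by
  have h := card_filter_le_exp m
    ({T : {T : Finset (Fin n) // #T = k} | T.1 ⊆ S} : Finset _) t θ hθ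
  simp only [mem_filter, mem_univ, true_and] at h
  refine h.trans ?_
  rw [card_subtype_subset, Fintype.card_finset_len, Fintype.card_fin]
  have hn : 0 < n := by omega
  have hq : ((#S).choose k : ℝ) ≤ n.choose k * (#S / n : ℝ) ^ 2 := by
    have : (((#S).choose k * n ^ 2 : ℕ) : ℝ) ≤ ((n.choose k * (#S) ^ 2 : ℕ) : ℝ) := by
      exact_mod_cast choose_mul_sq_le (by simpa using card_le_univ S) hk
    push_cast at this
    rw [div_pow, mul_div_assoc', le_div_iff₀ (by positivity)]
    exact this
  have hexp : 0 ≤ Real.exp θ - 1 := by linarith [Real.one_le_exp hθ]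
  rw [sub_eq_neg_add _ (θ * t), Real.exp_add, mul_left_comm, Real.exp_nat_mul, ← mul_pow]
  gcongr
  calc (n.choose k : ℝ) + (Real.exp θ - 1) * (#S).choose k
      ≤ n.choose k + (Real.exp θ - 1) * (n.choose k * (#S / n : ℝ) ^ 2) := by gcongr
    _ = n.choose k * ((#S / n : ℝ) ^ 2 * (Real.exp θ - 1) + 1) := by ring
    _ ≤ _ := by gcongr; exact Real.add_one_le_exp _

lemma exists_tilt {r₁ r₂ : ℝ} (hr₁ : 0 < r₁) (hr : r₁ < r₂) :
    ∃ c > 0, ∀ x : ℝ, 0 ≤ x → ∃ θ ≥ 0,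
      r₁ * (Real.exp (-x) * (Real.exp θ - 1)) - r₂ * θ ≤ -(c * (1 + x)) := by
  set δ : ℝ := (r₂ - r₁) / (2 * r₁) with hδ
  have hδ0 : 0 < δ := div_pos (by linarith) (by linarith)
  have hδr : r₁ * (1 + δ) < r₂ := by
    have : r₁ * δ = (r₂ - r₁) / 2 := by rw [hδ]; field_simp
    linarith
  have hlog : δ / (1 + δ) ≤ Real.log (1 + δ) := by
    have := Real.one_sub_inv_le_log_of_pos (show 0 < 1 + δ by linarith)
    convert this using 1
    field_simp
    ring
  have hgap : 0 < r₂ * Real.log (1 + δ) - r₁ * δ := by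
    have h1 : r₁ * δ < r₂ * (δ / (1 + δ)) := by
      rw [mul_div_assoc' r₂ δ, lt_div_iff₀ (by linarith)]
      nlinarith
    have h2 : r₂ * (δ / (1 + δ)) ≤ r₂ * Real.log (1 + δ) := by
      gcongr
      linarith
    linarith
  refine ⟨min (r₂ * Real.log (1 + δ) - r₁ * δ) ((r₂ - r₁) / 2),
    lt_min hgap (by linarith), fun x hx =>
    ⟨Real.log (1 + δ) + x / 2, add_nonneg (Real.log_nonneg (by linarith)) (by linarith), ?_⟩⟩
  set y := Real.exp (-(x / 2)) with hy
  have hy0 : 0 < y := Real.exp_pos _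
  have hy1 : y ≤ 1 := Real.exp_le_one_iff.mpr (by linarith)
  have hyx : 1 - y ≤ x / 2 := by
    have := Real.add_one_le_exp (-(x / 2))
    linarith
  have hxx : Real.exp (-x) = y * y := by
    rw [hy, ← Real.exp_add]; ring_nf
  have hyi : y * Real.exp (x / 2) = 1 := by
    rw [hy, ← Real.exp_add]; simp
  have hmain : Real.exp (-x) * (Real.exp (Real.log (1 + δ) + x / 2) - 1) ≤ δ + x / 2 := by
    rw [Real.exp_add, Real.exp_log (by linarith), hxx]
    have : y * y * ((1 + δ) * Real.exp (x / 2) - 1) = (1 + δ) * y - y * y := by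
      linear_combination (1 + δ) * y * hyi
    rw [this]
    nlinarith [mul_nonneg (sub_nonneg.mpr hy1) hδ0.le,
      mul_nonneg (sub_nonneg.mpr hy1) (sub_nonneg.mpr hy1)]
  have h1 := mul_le_mul_of_nonneg_left hmain hr₁.le
  have h2 := min_le_left (r₂ * Real.log (1 + δ) - r₁ * δ) ((r₂ - r₁) / 2)
  have h3 := mul_le_mul_of_nonneg_right
    (min_le_right (r₂ * Real.log (1 + δ) - r₁ * δ) ((r₂ - r₁) / 2)) hx
  linarith

lemma choose_le_exp {n s : ℕ} (hn : 0 < n) (hs : 0 < s) :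
    (n.choose s : ℝ) ≤ Real.exp (s * (1 + Real.log (n / s))) := by
  have hs' : (0 : ℝ) < s := by exact_mod_cast hs
  have hn' : (0 : ℝ) < n := by exact_mod_cast hn
  calc (n.choose s : ℝ) ≤ n ^ s / s.factorial := Nat.choose_le_pow_div s n
    _ = (n / s : ℝ) ^ s * (s ^ s / s.factorial) := by
        rw [div_pow]; field_simp
    _ ≤ (n / s : ℝ) ^ s * Real.exp s := by
        gcongr
        exact Real.pow_div_factorial_le_exp _ hs'.le _
    _ = _ := by
        rw [mul_add, mul_one, add_comm, Real.exp_add, Real.exp_nat_mul (Real.log _),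
          Real.exp_log (by positivity)]

/-- With high probability no set of variables spans many more constraints than the overall
constraint density allows. -/
lemma exists_card_exists_dense_le {k : ℕ} (hk : 2 ≤ k) {r₁ r₂ : ℝ} (hr₁ : 0 < r₁)
    (hr : r₁ < r₂) : ∃ c > 0, ∀ n m : ℕ, k ≤ n → (m : ℝ) ≤ r₁ * n * Real.log n →
      Real.exp (1 - c * Real.log n) ≤ 1 / 2 →
      (#{f : Fin m → {T : Finset (Fin n) // #T = k} | ∃ S : Finset (Fin n), S.Nonempty ∧
        r₂ * Real.log n * #S ≤ #{j | (f j).1 ⊆ S}} : ℝ) ≤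
      (Fintype.card {T : Finset (Fin n) // #T = k} : ℝ) ^ m *
        (2 * Real.exp (1 - c * Real.log n)) := by
  obtain ⟨c, hc, hθ⟩ := exists_tilt hr₁ hr
  refine ⟨c, hc, fun n m hkn hm hρ => ?_⟩
  set N : ℝ := (Fintype.card {T : Finset (Fin n) // #T = k} : ℝ) ^ m with hN
  set L := Real.log n
  set ρ := Real.exp (1 - c * L) with hρdef
  have hn : 0 < n := by omega
  have hn' : (0 : ℝ) < n := by exact_mod_cast hn
  have hL : 0 ≤ L := Real.log_natCast_nonneg n
  have hcL : 1 ≤ c * L := by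
    by_contra! h
    have := Real.one_le_exp (show 0 ≤ 1 - c * L by linarith)
    linarith
  let g : ℕ → ℝ := fun s => if s = 0 then 0 else
    N * Real.exp (-(c * L * (s * (1 + Real.log (n / s)))))
  have hS : ∀ S : Finset (Fin n), S.Nonempty →
      (#{f : Fin m → {T : Finset (Fin n) // #T = k} |
        r₂ * L * #S ≤ #{j | (f j).1 ⊆ S}} : ℝ) ≤ g #S := by
    intro S hSn
    have hs : 0 < #S := hSn.card_pos
    have hs' : (0 : ℝ) < #S := by exact_mod_cast hs
    have hsn : (#S : ℝ) ≤ n := by exact_mod_cast (by simpa using card_le_univ S : #S ≤ n)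
    have hx : 0 ≤ Real.log (n / #S) := Real.log_nonneg (by rwa [one_le_div hs'])
    obtain ⟨θ, hθ0, h⟩ := hθ _ hx
    rw [Real.exp_neg, Real.exp_log (by positivity), inv_div] at h
    refine (card_dense_le_exp hk hkn S _ θ hθ0).trans ?_
    simp only [g, hs.ne', if_false]
    gcongr
    have he : 0 ≤ Real.exp θ - 1 := by linarith [Real.one_le_exp hθ0]
    calc (m : ℝ) * ((#S / n : ℝ) ^ 2 * (Real.exp θ - 1)) - θ * (r₂ * L * #S)
        ≤ (r₁ * n * L) * ((#S / n : ℝ) ^ 2 * (Real.exp θ - 1)) - θ * (r₂ * L * #S) := by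
          gcongr
      _ = (L * #S) * (r₁ * (#S / n * (Real.exp θ - 1)) - r₂ * θ) := by
          field_simp
      _ ≤ (L * #S) * (-(c * (1 + Real.log (n / #S)))) := by gcongr
      _ = _ := by ring
  have hg0 : ∀ s, 0 ≤ g s := fun s => by
    simp only [g]; split_ifs <;> positivity
  calc _ ≤ (∑ S : Finset (Fin n), g #S : ℝ) := by
        have hsub : ({f : Fin m → {T : Finset (Fin n) // #T = k} | ∃ S : Finset (Fin n),
            S.Nonempty ∧ r₂ * L * #S ≤ #{j | (f j).1 ⊆ S}} : Finset _) ⊆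
            ({S : Finset (Fin n) | S.Nonempty} : Finset _).biUnion fun S =>
              {f : Fin m → {T : Finset (Fin n) // #T = k} |
                r₂ * L * #S ≤ #{j | (f j).1 ⊆ S}} := by
          intro f hf
          simpa using hf
        refine (Nat.cast_le.mpr ((card_le_card hsub).trans card_biUnion_le)).trans ?_
        rw [Nat.cast_sum]
        refine (sum_le_sum fun S hS' => hS S (by simpa using hS')).trans ?_
        exact sum_le_univ_sum_of_nonneg fun S => hg0 _
    _ = ∑ s ∈ range (n + 1), n.choose s * g s := by
        rw [← powerset_univ, sum_powerset_apply_card]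
        simp
    _ ≤ ∑ s ∈ Ico 1 (n + 1), N * ρ ^ s := by
        rw [range_eq_Ico, sum_eq_sum_Ico_succ_bot (by omega)]
        simp only [g, if_true, mul_zero, zero_add]
        refine sum_le_sum fun s hs => ?_
        rw [mem_Ico] at hs
        have hs' : (0 : ℝ) < s := by exact_mod_cast hs.1
        have hsn : (s : ℝ) ≤ n := by exact_mod_cast (by omega : s ≤ n)
        have hx : 0 ≤ Real.log (n / s) := Real.log_nonneg (by rwa [one_le_div hs'])
        rw [if_neg (by omega), mul_left_comm]
        gcongr
        refine (mul_le_mul_of_nonneg_right (choose_le_exp hn (by omega))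
          (Real.exp_nonneg _)).trans ?_
        rw [← Real.exp_add, hρdef, ← Real.exp_nat_mul]
        gcongr
        nlinarith [mul_nonneg (mul_nonneg hs'.le hx) (sub_nonneg.mpr hcL)]
    _ ≤ N * (2 * ρ) := by
        rw [← mul_sum]
        gcongr
        refine (geom_sum_Ico_le_of_lt_one (Real.exp_nonneg _) (by linarith)).trans ?_
        rw [pow_one, div_le_iff₀ (by linarith)]
        nlinarith [Real.exp_pos (1 - c * L)]

/-- A hypergraph all of whose spanned subhypergraphs have a vertex of degree less than `b`
has an ordering in which all back-degrees are less than `b`. -/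
lemma exists_perm_backDegree_lt {ι : Type*} [Fintype ι] {n : ℕ} (f : ι → Finset (Fin n)) (b : ℝ)
    (h : ∀ S : Finset (Fin n), S.Nonempty → ∃ v ∈ S, (#{j | f j ⊆ S ∧ v ∈ f j} : ℝ) < b) :
    ∃ π : Equiv.Perm (Fin n), ∀ i,
      (#{j | f j ⊆ (Iic i).image π ∧ π i ∈ f j} : ℝ) < b := by
  have key : ∀ s : ℕ, ∀ S : Finset (Fin n), #S = s → ∃ ρ : Fin n → ℕ, Set.InjOn ρ S ∧
      (∀ v ∈ S, ρ v < s) ∧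
      ∀ v ∈ S, (#{j | f j ⊆ {w ∈ S | ρ w ≤ ρ v} ∧ v ∈ f j} : ℝ) < b := by
    intro s
    induction s with
    | zero =>
      intro S hS
      obtain rfl := card_eq_zero.mp hS
      exact ⟨fun _ => 0, by simp, by simp, by simp⟩
    | succ s ih =>
      intro S hS
      obtain ⟨v, hv, hd⟩ := h S (card_pos.mp (by omega))
      obtain ⟨ρ, hinj, hlt, hρ⟩ := ih (S.erase v) (by rw [card_erase_of_mem hv]; omega)
      have hlt' : ∀ w ∈ S, w ≠ v → ρ w < s := fun w hw hwv => hlt w (mem_erase.mpr ⟨hwv, hw⟩)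
      refine ⟨Function.update ρ v s, ?_, ?_, ?_⟩
      · intro a ha a' ha' haa
        rw [mem_coe] at ha ha'
        by_cases h1 : a = v <;> by_cases h2 : a' = v
        · rw [h1, h2]
        · subst h1
          have := hlt' a' ha' h2
          simp [Function.update_of_ne h2] at haa
          omega
        · subst h2
          have := hlt' a ha h1
          simp [Function.update_of_ne h1] at haa
          omega
        · rw [Function.update_of_ne h1, Function.update_of_ne h2] at haa
          exact hinj (by simp [h1, ha]) (by simp [h2, ha']) haa
      · intro w hw
        by_cases h1 : w = v
        · subst h1; simp
        · rw [Function.update_of_ne h1]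
          have := hlt' w hw h1
          omega
      · intro w hw
        by_cases h1 : w = v
        · subst h1
          refine lt_of_le_of_lt ?_ hd
          gcongr
          exact filter_subset _ _
        · refine lt_of_le_of_lt ?_ (hρ w (mem_erase.mpr ⟨h1, hw⟩))
          rw [Function.update_of_ne h1]
          gcongr
          intro x hx
          have h2 := mem_filter.mp hx
          have h3 : x ≠ v := by
            rintro rfl
            have := hlt' w hw h1
            simp at h2
            omega
          rw [Function.update_of_ne h3] at h2
          simp [h3, h2]
  obtain ⟨ρ, hinj, hlt, hρ⟩ := key n univ (by simp)
  let e : Fin n → Fin n := fun v => ⟨ρ v, hlt v (mem_univ v)⟩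
  have he : Function.Injective e := fun a b hab =>
    hinj (by simp) (by simp) (by simpa [e] using hab)
  let σ : Equiv.Perm (Fin n) := Equiv.ofBijective e (Finite.injective_iff_bijective.mp he)
  refine ⟨σ.symm, fun i => ?_⟩
  refine lt_of_le_of_lt ?_ (hρ (σ.symm i) (mem_univ _))
  gcongr
  intro x hx
  obtain ⟨y, hy, rfl⟩ := mem_image.mp hx
  have h1 : ∀ z, ρ (σ.symm z) = z := fun z => congrArg Fin.val (σ.apply_symm_apply z)
  simp only [mem_filter, mem_univ, true_and, h1]
  exact Fin.le_def.mp (mem_Iic.mp hy)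

/-- If `S` spans fewer than `a * #S` of the `k`-element sets `f j`, then some vertex of `S` lies
in fewer than `k * a` of those. -/
lemma exists_degree_lt {ι V : Type*} [Fintype ι] [DecidableEq V] {k : ℕ} (hk : 0 < k)
    (f : ι → Finset V) (hf : ∀ j, #(f j) = k) {S : Finset V} {a : ℝ}
    (h : (#{j | f j ⊆ S} : ℝ) < a * #S) :
    ∃ v ∈ S, (#{j | f j ⊆ S ∧ v ∈ f j} : ℝ) < k * a := by
  by_contra! hcon
  have h1 := sum_le_sum hcon
  have h2 : ∑ v ∈ S, #{j | f j ⊆ S ∧ v ∈ f j} = #{j | f j ⊆ S} * k := by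
    have := sum_card_bipartiteAbove_eq_sum_card_bipartiteBelow
      (s := S) (t := ({j | f j ⊆ S} : Finset ι)) (fun v j => v ∈ f j)
    simp only [bipartiteAbove, bipartiteBelow, filter_filter] at this
    rw [this, ← smul_eq_mul, ← sum_const]
    refine sum_congr rfl fun j hj => ?_
    rw [← hf j, filter_mem_eq_inter, inter_eq_right.mpr (mem_filter.mp hj).2]
  rw [sum_const, nsmul_eq_mul, ← Nat.cast_sum, h2] at h1
  push_cast at h1
  have hk' : (0 : ℝ) < k := by exact_mod_cast hk
  nlinarith

lemma sum_biUnion_le_sum {ι X : Type*} [DecidableEq X] (s : Finset ι) (t : ι → Finset X)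
    {w : X → ℝ} (hw : ∀ x, 0 ≤ w x) : ∑ x ∈ s.biUnion t, w x ≤ ∑ i ∈ s, ∑ x ∈ t i, w x := by
  classical
  induction s using Finset.induction_on with
  | empty => simp
  | insert i s hi ih =>
    rw [biUnion_insert, sum_insert hi]
    have := sum_union_inter (s₁ := t i) (s₂ := s.biUnion t) (f := w)
    have := sum_nonneg (s := t i ∩ s.biUnion t) fun x _ => hw x
    linarith

lemma rdCompat_congr {n d m k : ℕ} {ω : RDOmega n d m k} {j : Fin m} {c c' : Fin n → Fin d}
    (h : ∀ v ∈ (ω.1 j).1, c v = c' v) : rdCompat ω j c ↔ rdCompat ω j c' := by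
  have : (fun v => if v ∈ (ω.1 j).1 then some (c v) else none) =
      fun v => if v ∈ (ω.1 j).1 then some (c' v) else none := by
    funext v
    split_ifs with hv
    · rw [h v hv]
    · rfl
  simp only [rdCompat, this]

lemma rdWeight_curry {p : ℝ} {n d m k : ℕ}
    (f : Fin m → {S : Finset (Fin n) // #S = k})
    (F : Fin m × (Fin n → Option (Fin d)) → Bool) :
    rdWeight p ((f, Function.curry F) : RDOmega n d m k) =
      ((Fintype.card {S : Finset (Fin n) // #S = k} : ℝ))⁻¹ ^ m * flagWeight p F := by
  rw [rdWeight, flagWeight, Fintype.prod_prod_type]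
  rfl

open Classical in
lemma rdPr_eq_sum (p : ℝ) (n d m k : ℕ) (E : RDOmega n d m k → Prop) :
    rdPr p n d m k E = ∑ f : Fin m → {S : Finset (Fin n) // #S = k},
      ((Fintype.card {S : Finset (Fin n) // #S = k} : ℝ))⁻¹ ^ m *
        ∑ F : Fin m × (Fin n → Option (Fin d)) → Bool with E (f, Function.curry F),
          flagWeight p F := by
  rw [rdPr, sum_filter, Fintype.sum_prod_type]
  refine sum_congr rfl fun f _ => ?_
  rw [mul_sum, sum_filter, ← (Equiv.curry _ _ _).sum_comp]
  refine sum_congr rfl fun F _ => ?_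
  have h := rdWeight_curry (p := p) f F
  rw [← h]
  rfl

lemma rdPr_true (p : ℝ) {n d m k : ℕ} (hkn : k ≤ n) : rdPr p n d m k (fun _ => True) = 1 := by
  classical
  rw [rdPr_eq_sum]
  simp only [filter_true, sum_flagWeight, mul_one, sum_const, card_univ, Fintype.card_fun,
    Fintype.card_fin, nsmul_eq_mul, Nat.cast_pow, Fintype.card_finset_len]
  have : (n.choose k : ℝ) ≠ 0 := by exact_mod_cast (Nat.choose_pos hkn).ne'
  rw [← mul_pow, mul_inv_cancel₀ this, one_pow]

lemma rdPr_add_rdPr_not (p : ℝ) {n d m k : ℕ} (hkn : k ≤ n) (E : RDOmega n d m k → Prop) :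
    rdPr p n d m k E + rdPr p n d m k (fun ω => ¬ E ω) = 1 := by
  classical
  rw [← rdPr_true p (d := d) (m := m) hkn, rdPr, rdPr, rdPr, sum_filter,
    sum_filter, sum_filter, ← sum_add_distrib]
  refine sum_congr rfl fun ω _ => ?_
  by_cases h : E ω <;> simp [h]

lemma rdPr_nonneg {p : ℝ} (hp0 : 0 ≤ p) (hp1 : p ≤ 1) (n d m k : ℕ)
    (E : RDOmega n d m k → Prop) : 0 ≤ rdPr p n d m k E := by
  rw [rdPr_eq_sum]
  exact sum_nonneg fun f _ => mul_nonneg (by positivity)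
    (sum_nonneg fun F _ => flagWeight_nonneg hp0 hp1 F)

/-- If the scopes violate `G` with probability at most `η₁`, and `E` has conditional probability
at most `η₂` given scopes satisfying `G`, then `E` has probability at most `η₁ + η₂`. -/
lemma rdPr_le_add {p : ℝ} (hp0 : 0 ≤ p) (hp1 : p ≤ 1) {n d m k : ℕ} (hkn : k ≤ n)
    (E : RDOmega n d m k → Prop) (G : (Fin m → {S : Finset (Fin n) // #S = k}) → Prop)
    [DecidablePred G] {η₁ η₂ : ℝ} (hη₂ : 0 ≤ η₂)
    (h₁ : (#{f | ¬ G f} : ℝ) ≤ (Fintype.card {S : Finset (Fin n) // #S = k} : ℝ) ^ m * η₁)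
    (h₂ : ∀ f, G f → ∀ [DecidablePred fun F : Fin m × (Fin n → Option (Fin d)) → Bool =>
      E (f, Function.curry F)], ∑ F : Fin m × (Fin n → Option (Fin d)) → Bool
        with E (f, Function.curry F), flagWeight p F ≤ η₂) :
    rdPr p n d m k E ≤ η₁ + η₂ := by
  classical
  have hN : (0 : ℝ) < Fintype.card {S : Finset (Fin n) // #S = k} := by
    rw [Fintype.card_finset_len, Fintype.card_fin]
    exact_mod_cast Nat.choose_pos hkn
  rw [rdPr_eq_sum, ← mul_sum]
  have h : ∀ f : Fin m → {S : Finset (Fin n) // #S = k},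
      ∑ F : Fin m × (Fin n → Option (Fin d)) → Bool with E (f, Function.curry F),
        flagWeight p F ≤ (if ¬ G f then 1 else 0) + η₂ := by
    intro f
    by_cases hf : G f
    · simpa [hf] using h₂ f hf
    · have : ∑ F : Fin m × (Fin n → Option (Fin d)) → Bool with E (f, Function.curry F),
          flagWeight p F ≤ 1 := by
        rw [← sum_flagWeight (X := Fin m × (Fin n → Option (Fin d))) p]
        exact sum_le_univ_sum_of_nonneg fun F => flagWeight_nonneg hp0 hp1 F
      simp only [hf, not_false_iff, if_true]
      linarith
  refine (mul_le_mul_of_nonneg_left (sum_le_sum fun f _ => h f) (by positivity)).trans ?_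
  rw [sum_add_distrib, sum_boole, sum_const, card_univ, Fintype.card_fun, Fintype.card_fin,
    nsmul_eq_mul, inv_pow, inv_mul_le_iff₀ (by positivity), mul_add, Nat.cast_pow]
  gcongr

/-- The probability that all `d` extensions of a partial assignment to `v` violate one of the
constraints in `B`, all of which contain `v`. -/
lemma sum_flagWeight_forall_extension_violated {n d m k : ℕ} (p : ℝ)
    (f : Fin m → {S : Finset (Fin n) // #S = k}) (B : Finset (Fin m)) (u : Fin n)
    (hB : ∀ j ∈ B, u ∈ (f j).1) (c : Fin n → Fin d)
    [DecidablePred fun F : Fin m × (Fin n → Option (Fin d)) → Bool =>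
      ∀ v, ∃ j ∈ B, ¬ rdCompat ((f, Function.curry F) : RDOmega n d m k) j
        (Function.update c u v)] :
    ∑ F : Fin m × (Fin n → Option (Fin d)) → Bool with
      (∀ v, ∃ j ∈ B, ¬ rdCompat ((f, Function.curry F) : RDOmega n d m k) j
        (Function.update c u v)), flagWeight p F = (1 - (1 - p) ^ #B) ^ d := by
  classical
  let g : Fin d → Fin m → Fin m × (Fin n → Option (Fin d)) := fun v j =>
    (j, fun w => if w ∈ (f j).1 then some (Function.update c u v w) else none)
  have hg : ∀ v, Function.Injective (g v) := fun v j j' h => congrArg Prod.fst h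
  have hA : Pairwise fun v w => Disjoint (B.image (g v)) (B.image (g w)) := by
    intro v w hvw
    rw [disjoint_left]
    intro x hx hx'
    obtain ⟨j, hj, rfl⟩ := mem_image.mp hx
    obtain ⟨j', hj', h⟩ := mem_image.mp hx'
    obtain rfl : j' = j := congrArg Prod.fst h
    have := congrFun (congrArg Prod.snd h) u
    simp only [g, hB _ hj, if_true, Function.update_self, Option.some.injEq] at this
    exact hvw this.symm
  have h := sum_flagWeight_forall_exists_false p (fun v => B.image (g v)) hA
  simp only [card_image_of_injective B (hg _), prod_const, card_univ, Fintype.card_fin] at h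
  rw [← h]
  refine sum_congr (Finset.ext fun F => ?_) fun _ _ => rfl
  simp [rdCompat, g, Function.curry]

/-- If the ordering `π` is not backtrack-free, then for some variable and some assignment on the
variables involved in its back-constraints, all extensions violate one of these. -/
lemma exists_of_not_rdBacktrackFree {n d m k : ℕ} {ω : RDOmega n d m k}
    (h : ¬ rdBacktrackFree ω) (π : Equiv.Perm (Fin n)) (B : Fin n → Finset (Fin m))
    (hB : ∀ i, B i = ({j | (ω.1 j).1 ⊆ (Iic i).image π ∧ π i ∈ (ω.1 j).1} : Finset _))
    (z : Fin d) :
    ∃ i, ∃ c ∈ Fintype.piFinset fun v =>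
        if v ∈ (B i).biUnion (fun j => (ω.1 j).1) then (univ : Finset (Fin d)) else {z},
      ∀ v, ∃ j ∈ B i, ¬ rdCompat ω j (Function.update c (π i) v) := by
  unfold rdBacktrackFree at h
  push Not at h
  obtain ⟨i, c, hc, hv⟩ := h π
  refine ⟨i, fun v => if v ∈ (B i).biUnion (fun j => (ω.1 j).1) then c v else z, ?_, ?_⟩
  · rw [Fintype.mem_piFinset]
    intro v
    split_ifs <;> simp
  · intro v
    obtain ⟨j, hj, hjv⟩ := hv v
    have hmem : π i ∈ (ω.1 j).1 := by
      by_contra hi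
      refine hjv ((rdCompat_congr fun w hw => ?_).mp (hc j fun w hw => ?_))
      · rw [Function.update_of_ne]
        rintro rfl
        exact hi hw
      · obtain ⟨y, hy, rfl⟩ := mem_image.mp (hj hw)
        refine mem_image_of_mem _ (mem_Iio.mpr (lt_of_le_of_ne (mem_Iic.mp hy) ?_))
        rintro rfl
        exact hi hw
    have hjB : j ∈ B i := by rw [hB]; simp [hj, hmem]
    refine ⟨j, hjB, fun hcon => hjv ((rdCompat_congr fun w hw => ?_).mp hcon)⟩
    by_cases hwi : w = π i
    · subst hwi; simp
    · rw [Function.update_of_ne hwi, Function.update_of_ne hwi, if_pos]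
      exact mem_biUnion.mpr ⟨j, hjB, hw⟩

/-- Given scopes with an ordering with back-degrees less than `b`, the conditional probability
of not being backtrack-free is small. -/
lemma sum_flagWeight_not_rdBacktrackFree_le {p : ℝ} (hp0 : 0 < p) (hp1 : p < 1) {n d m k : ℕ}
    (hd : 0 < d) (f : Fin m → {S : Finset (Fin n) // #S = k}) (b : ℝ) (π : Equiv.Perm (Fin n))
    (hπ : ∀ i, (#{j | (f j).1 ⊆ (Iic i).image π ∧ π i ∈ (f j).1} : ℝ) < b)
    [DecidablePred fun F : Fin m × (Fin n → Option (Fin d)) → Bool =>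
      ¬ rdBacktrackFree ((f, Function.curry F) : RDOmega n d m k)] :
    ∑ F : Fin m × (Fin n → Option (Fin d)) → Bool with
      ¬ rdBacktrackFree ((f, Function.curry F) : RDOmega n d m k), flagWeight p F ≤
      n * Real.exp (k * b * Real.log d - d * Real.exp (b * Real.log (1 - p))) := by
  classical
  let z : Fin d := ⟨0, hd⟩
  let B : Fin n → Finset (Fin m) := fun i =>
    {j | (f j).1 ⊆ (Iic i).image π ∧ π i ∈ (f j).1}
  let C : Fin n → Finset (Fin n → Fin d) := fun i => Fintype.piFinset fun v =>
    if v ∈ (B i).biUnion (fun j => (f j).1) then (univ : Finset (Fin d)) else {z}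
  let bad : Fin n → (Fin n → Fin d) → Finset (Fin m × (Fin n → Option (Fin d)) → Bool) :=
    fun i c => {F | ∀ v, ∃ j ∈ B i, ¬ rdCompat ((f, Function.curry F) : RDOmega n d m k) j
      (Function.update c (π i) v)}
  have hcard : ∀ i, (#(C i) : ℝ) ≤ Real.exp (k * b * Real.log d) := by
    intro i
    have h1 : #(C i) = d ^ #((B i).biUnion fun j => (f j).1) := by
      simp only [C, Fintype.card_piFinset]
      have : ∀ v : Fin n, #(if v ∈ (B i).biUnion (fun j => (f j).1) then
          (univ : Finset (Fin d)) else {z}) =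
          if v ∈ (B i).biUnion (fun j => (f j).1) then d else 1 := by
        intro v; split_ifs <;> simp
      simp_rw [this]
      rw [prod_ite_mem, univ_inter, prod_const]
    have h2 : (#((B i).biUnion fun j => (f j).1) : ℝ) ≤ k * b := by
      have := card_biUnion_le_card_mul (B i) (fun j => (f j).1) k fun j _ => (f j).2.le
      calc (#((B i).biUnion fun j => (f j).1) : ℝ) ≤ #(B i) * k := by exact_mod_cast this
        _ ≤ b * k := by gcongr; exact (hπ i).le
        _ = _ := mul_comm _ _
    have hd' : (0 : ℝ) < d := by exact_mod_cast hd
    rw [h1, Nat.cast_pow, ← Real.rpow_natCast, Real.rpow_def_of_pos hd', mul_comm]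
    have : 0 ≤ Real.log d := Real.log_natCast_nonneg d
    gcongr
  have hbad : ∀ i c, ∑ F ∈ bad i c, flagWeight p F ≤
      Real.exp (-(d * Real.exp (b * Real.log (1 - p)))) := by
    intro i c
    simp only [bad]
    rw [sum_flagWeight_forall_extension_violated p f (B i) (π i)
      (fun j hj => (mem_filter.mp hj).2.2) c]
    rw [← mul_neg, Real.exp_nat_mul]
    have h0 : (1 - p) ^ #(B i) ≤ 1 := pow_le_one₀ (by linarith) (by linarith)
    have h1 : Real.exp (b * Real.log (1 - p)) ≤ (1 - p) ^ #(B i) := by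
      rw [← Real.rpow_natCast, Real.rpow_def_of_pos (by linarith), mul_comm b]
      refine Real.exp_le_exp.mpr (mul_le_mul_of_nonpos_left (hπ i).le
        (Real.log_nonpos (by linarith) (by linarith)))
    have h2 := Real.add_one_le_exp (-Real.exp (b * Real.log (1 - p)))
    exact pow_le_pow_left₀ (by linarith) (by linarith) d
  have hw : ∀ F : Fin m × (Fin n → Option (Fin d)) → Bool, 0 ≤ flagWeight p F :=
    flagWeight_nonneg hp0.le hp1.le
  calc _ ≤ ∑ F ∈ univ.biUnion fun i => (C i).biUnion (bad i), flagWeight p F := by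
        refine sum_le_sum_of_subset_of_nonneg (fun F hF => ?_) fun F _ _ => hw F
        obtain ⟨i, c, hc, h⟩ := exists_of_not_rdBacktrackFree (mem_filter.mp hF).2 π B
          (fun i => rfl) z
        simp only [mem_biUnion, mem_univ, true_and]
        exact ⟨i, c, hc, by simpa [bad] using h⟩
    _ ≤ ∑ i, ∑ c ∈ C i, ∑ F ∈ bad i c, flagWeight p F := by
        refine (sum_biUnion_le_sum _ _ hw).trans (sum_le_sum fun i _ => ?_)
        exact sum_biUnion_le_sum _ _ hw
    _ ≤ ∑ i : Fin n, Real.exp (k * b * Real.log d) *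
          Real.exp (-(d * Real.exp (b * Real.log (1 - p)))) := by
        refine sum_le_sum fun i _ => (sum_le_sum fun c _ => hbad i c).trans ?_
        rw [sum_const, nsmul_eq_mul]
        gcongr
        exact hcard i
    _ = _ := by
        rw [sum_const, card_univ, Fintype.card_fin, nsmul_eq_mul, ← Real.exp_add,
          ← sub_eq_add_neg]

lemma log_ceil_rpow_le {n : ℕ} (hn : 2 ≤ n) {α : ℝ} (hα : 0 < α) :
    Real.log ⌈(n : ℝ) ^ α⌉₊ ≤ (α + 1) * Real.log n := by
  have hn' : (2 : ℝ) ≤ n := by exact_mod_cast hn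
  have hn0 : (0 : ℝ) < n := by linarith
  have h1 : 1 ≤ (n : ℝ) ^ α := Real.one_le_rpow (by linarith) hα.le
  rw [← Real.log_rpow hn0]
  refine Real.log_le_log (by exact_mod_cast Nat.ceil_pos.mpr (by linarith)) ?_
  rw [Real.rpow_add hn0, Real.rpow_one]
  nlinarith [Nat.ceil_lt_add_one (zero_le_one.trans h1)]

lemma tendsto_exp_sub_exp {β K : ℝ} (hβ : 0 < β) :
    Filter.Tendsto (fun x : ℝ => Real.exp (x + K * x ^ 2 - Real.exp (β * x)))
      Filter.atTop (nhds 0) := by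
  refine Real.tendsto_exp_atBot.comp ?_
  have hexp : Filter.Tendsto (fun x : ℝ => Real.exp (β * x)) Filter.atTop Filter.atTop :=
    Real.tendsto_exp_atTop.comp (Filter.tendsto_id.const_mul_atTop hβ)
  have ho : (fun x : ℝ => x ^ 1 + K * x ^ 2) =o[Filter.atTop] fun x => Real.exp (β * x) :=
    (isLittleO_pow_exp_pos_mul_atTop 1 hβ).add
      ((isLittleO_pow_exp_pos_mul_atTop 2 hβ).const_mul_left K)
  refine Filter.tendsto_atBot_mono' _ ?_
    (hexp.const_mul_atTop_of_neg (show (-(1 / 2) : ℝ) < 0 by norm_num))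
  filter_upwards [ho.bound (show (0 : ℝ) < 1 / 2 by norm_num)] with x hx
  rw [Real.norm_eq_abs, Real.norm_eq_abs, abs_of_pos (Real.exp_pos _), pow_one] at hx
  have := le_abs_self (x + K * x ^ 2)
  linarith

/-- Let `α > 0`, `p ∈ (0,1)`, `k ≥ 2` and `r_bf = -α/(k ln(1-p))`. If `0 < r < r_bf`,
then the probability that a random instance of Model RD (with domain size `d = ⌈n^α⌉` and
`m = ⌈r n ln n⌉` constraints) is backtrack-free tends to `1` as `n → ∞`. -/
theorem rd_backtrackFree_below (α p r : ℝ) (k : ℕ) (hα : 0 < α) (hp0 : 0 < p) (hp1 : p < 1)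
    (hk : 2 ≤ k) (hr0 : 0 < r) (hr : r < -α / (k * Real.log (1 - p))) :
    Filter.Tendsto
      (fun n : ℕ => rdPr p n ⌈(n : ℝ) ^ α⌉₊ ⌈r * n * Real.log n⌉₊ k rdBacktrackFree)
      Filter.atTop (nhds 1) := by
  classical
  have hlog : Real.log (1 - p) < 0 := Real.log_neg (by linarith) (by linarith)
  have hk0 : (0 : ℝ) < k := by exact_mod_cast (by omega : 0 < k)
  obtain ⟨r₁, hr₁, hr₁'⟩ := exists_between hr
  obtain ⟨r₂, hr₂, hr₂'⟩ := exists_between hr₁'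
  have hβ : 0 < α + k * r₂ * Real.log (1 - p) := by
    rw [lt_div_iff_of_neg (mul_neg_of_pos_of_neg hk0 hlog)] at hr₂'
    linarith
  obtain ⟨c, hc, hdense⟩ := exists_card_exists_dense_le hk (hr0.trans hr₁) hr₂
  have hL : Filter.Tendsto (fun n : ℕ => Real.log n) Filter.atTop Filter.atTop :=
    Real.tendsto_log_atTop.comp tendsto_natCast_atTop_atTop
  have hη₁ : Filter.Tendsto (fun n : ℕ => Real.exp (1 - c * Real.log n)) Filter.atTop
      (nhds 0) := by
    refine Real.tendsto_exp_atBot.comp ?_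
    simp_rw [sub_eq_add_neg, ← neg_mul]
    exact Filter.tendsto_atBot_add_const_left _ _
      (hL.const_mul_atTop_of_neg (neg_neg_of_pos hc))
  have hη₂ := (tendsto_exp_sub_exp (K := k * (k * r₂) * (α + 1)) hβ).comp hL
  have hlim : Filter.Tendsto (fun n : ℕ => 1 - (2 * Real.exp (1 - c * Real.log n) +
      Real.exp (Real.log n + k * (k * r₂) * (α + 1) * Real.log n ^ 2 -
        Real.exp ((α + k * r₂ * Real.log (1 - p)) * Real.log n)))) Filter.atTop (nhds 1) := by
    simpa using ((hη₁.const_mul 2).add hη₂).const_sub 1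
  refine tendsto_of_tendsto_of_tendsto_of_le_of_le' hlim tendsto_const_nhds ?_ ?_
  · filter_upwards [Filter.eventually_ge_atTop k, Filter.eventually_ge_atTop 2,
      hη₁.eventually_le_const (show (0 : ℝ) < 1 / 2 by norm_num),
      hL.eventually_ge_atTop (1 / (r₁ - r))] with n hkn hn hρ hLn
    have hadd := rdPr_add_rdPr_not p hkn
      (rdBacktrackFree (n := n) (d := ⌈(n : ℝ) ^ α⌉₊) (m := ⌈r * n * Real.log n⌉₊) (k := k))
    have hn' : (2 : ℝ) ≤ n := by exact_mod_cast hn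
    have hn0 : (0 : ℝ) < n := by linarith
    have hL0 : 0 ≤ Real.log n := Real.log_natCast_nonneg n
    have hm : (⌈r * n * Real.log n⌉₊ : ℝ) ≤ r₁ * n * Real.log n := by
      rw [div_le_iff₀ (by linarith)] at hLn
      have := Nat.ceil_lt_add_one (show 0 ≤ r * n * Real.log n by positivity)
      nlinarith
    have hnα : (0 : ℝ) < (n : ℝ) ^ α := by positivity
    have hfail := rdPr_le_add hp0.le hp1.le (d := ⌈(n : ℝ) ^ α⌉₊) hkn
      (fun ω => ¬ rdBacktrackFree ω)
      (fun f => ¬ ∃ S : Finset (Fin n), S.Nonempty ∧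
        r₂ * Real.log n * #S ≤ #{j | (f j).1 ⊆ S})
      (η₂ := Real.exp (Real.log n + k * (k * r₂) * (α + 1) * Real.log n ^ 2 -
        Real.exp ((α + k * r₂ * Real.log (1 - p)) * Real.log n)))
      (Real.exp_nonneg _) (by simpa only [not_not] using hdense n _ hkn hm hρ) ?_
    · linarith
    · intro f hf _
      push Not at hf
      obtain ⟨π, hπ⟩ := exists_perm_backDegree_lt (fun j => (f j).1)
        (k * (r₂ * Real.log n)) fun S hS =>
          exists_degree_lt (by omega) _ (fun j => (f j).2) (hf S hS)
      refine (sum_flagWeight_not_rdBacktrackFree_le hp0 hp1 (Nat.ceil_pos.mpr hnα) f _ π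
        hπ).trans ?_
      nth_rewrite 1 [← Real.exp_log hn0]
      rw [← Real.exp_add, add_sub_assoc]
      refine Real.exp_le_exp.mpr (add_le_add le_rfl (sub_le_sub ?_ ?_))
      · have := log_ceil_rpow_le hn hα
        have hr₂0 : 0 < r₂ := by linarith
        calc k * (k * (r₂ * Real.log n)) * Real.log ⌈(n : ℝ) ^ α⌉₊
            ≤ k * (k * (r₂ * Real.log n)) * ((α + 1) * Real.log n) := by gcongr
          _ = _ := by ring
      · calc Real.exp ((α + k * r₂ * Real.log (1 - p)) * Real.log n)
            = (n : ℝ) ^ α * Real.exp (k * (r₂ * Real.log n) * Real.log (1 - p)) := by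
              rw [Real.rpow_def_of_pos hn0, ← Real.exp_add]
              ring_nf
          _ ≤ _ := by gcongr; exact Nat.le_ceil _
  · filter_upwards [Filter.eventually_ge_atTop k] with n hkn
    have hadd := rdPr_add_rdPr_not p hkn
      (rdBacktrackFree (n := n) (d := ⌈(n : ℝ) ^ α⌉₊) (m := ⌈r * n * Real.log n⌉₊) (k := k))
    have := rdPr_nonneg hp0.le hp1.le n ⌈(n : ℝ) ^ α⌉₊ ⌈r * n * Real.log n⌉₊ k
      fun ω => ¬ rdBacktrackFree ω
    linarith
end
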